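/- If every countable product of compact metrizable spaces is separable, then CUC holds. -/

import Mathlib

open TopologicalSpace

/-- CUC: every countable union of countable sets is countable. -/
def CUC : Prop :=
  ∀ (Y : Type) (A : ℕ → Set Y), (∀ n, (A n).Countable) → (⋃ n, A n).Countable

/-- The one-point compactification of a countable discrete space is metrizable: it embeds into the
real line as a null sequence together with its limit. -/
theorem metrizableSpace_onePoint_of_countable_discrete (α : Type*) [TopologicalSpace α]
    [DiscreteTopology α] [Countable α] : MetrizableSpace (OnePoint α) := by
  obtain ⟨e, he⟩ := exists_injective_nat α
  let f : OnePoint α → ℝ := fun x => x.elim 0 fun a => 1 / ((e a : ℝ) + 1)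
  have f_infty : f OnePoint.infty = 0 := rfl
  have f_coe (a : α) : f a = 1 / ((e a : ℝ) + 1) := rfl
  have f_coe_pos (a : α) : 0 < f a := by rw [f_coe]; positivity
  have f_continuous : Continuous f := by
    rw [OnePoint.continuous_iff_from_discrete, f_infty]
    exact tendsto_one_div_add_atTop_nhds_zero_nat.comp
      (Nat.cofinite_eq_atTop ▸ he.tendsto_cofinite)
  have f_injective : Function.Injective f := by
    intro x y hxy
    induction x using OnePoint.rec with
    | infty =>
      induction y using OnePoint.rec with
      | infty => rfl
      | coe b => exact absurd hxy (f_coe_pos b).ne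
    | coe a =>
      induction y using OnePoint.rec with
      | infty => exact absurd hxy (f_coe_pos a).ne'
      | coe b =>
        rw [f_coe, f_coe, one_div, one_div, inv_inj, add_left_inj, Nat.cast_inj] at hxy
        rw [he hxy]
  exact (f_continuous.isClosedEmbedding f_injective).isEmbedding.metrizableSpace

/-- If every countable product of compact metrizable spaces is separable,
then CUC holds. -/
theorem stmt_14 :
    (∀ (X : ℕ → Type) [∀ n, TopologicalSpace (X n)],
       (∀ n, CompactSpace (X n)) → (∀ n, MetrizableSpace (X n)) →
       SeparableSpace (∀ n, X n)) → CUC := by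
  intro h Y A hA
  let _ (n : ℕ) : TopologicalSpace (A n) := ⊥
  have (n : ℕ) : DiscreteTopology (A n) := ⟨rfl⟩
  have (n : ℕ) : Countable (A n) := (hA n).to_subtype
  obtain ⟨D, hD, hdense⟩ := (h (fun n => OnePoint (A n)) (fun _ => inferInstance)
    fun n => metrizableSpace_onePoint_of_countable_discrete (A n)).exists_countable_dense
  have hD' : Countable D := hD
  let g : D × ℕ → Option Y := fun p => (p.1.1 p.2).elim none fun a => some a
  refine ((Set.countable_range g).preimage (Option.some_injective Y)).mono ?_
  intro y hy
  obtain ⟨n, hn⟩ := Set.mem_iUnion.mp hy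
  let a : A n := ⟨y, hn⟩
  have hopen : IsOpen ((fun x : ∀ n, OnePoint (A n) => x n) ⁻¹' {(a : OnePoint (A n))}) := by
    refine IsOpen.preimage (continuous_apply n) ?_
    rw [← Set.image_singleton]
    exact OnePoint.isOpenEmbedding_coe.isOpenMap _ (isOpen_discrete {a})
  obtain ⟨d, hda, hdD⟩ := hdense.inter_open_nonempty _ hopen ⟨fun m => if hm : m = n then
    hm ▸ (a : OnePoint (A n)) else OnePoint.infty, by simp⟩
  have hda' : d n = (a : OnePoint (A n)) := hda
  refine ⟨(⟨d, hdD⟩, n), ?_⟩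
  change (d n).elim none (fun a => some (a : Y)) = some y
  rw [hda', OnePoint.elim_some]
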